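/- Let ℓ = 2 or let ℓ > 2 be odd, let n ≥ 1 be an integer, and let q > 0 be the real number with n = 2(q^ℓ + q^{ℓ−1} + ⋯ + q + 1). If G is a bipartite graph on n vertices containing no cycle of length 2m for any 2 ≤ m ≤ ℓ and e(G) = (q+1)n/2, then q is a positive integer, the two parts of G each have size n/2, every vertex of G has degree q + 1, and any two vertices of G are at distance at most ℓ + 1. -/

import Mathlib

open SimpleGraph

/-- `G` contains a cycle of length `m` (as a subgraph). -/
def HasCycleLength {V : Type*} (G : SimpleGraph V) (m : ℕ) : Prop :=
  ∃ (v : V) (w : G.Walk v v), w.IsCycle ∧ w.length = m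

/-- `G` is `𝓒_{2ℓ}`-free: it contains no cycle of length `2m` for any `2 ≤ m ≤ ℓ`. -/
def EvenCycleFree {V : Type*} (G : SimpleGraph V) (ℓ : ℕ) : Prop :=
  ∀ m, 2 ≤ m → m ≤ ℓ → ¬ HasCycleLength G (2 * m)

/-- Short paths with common endpoints are unique. -/
def ShortPathUnique {V : Type*} (G : SimpleGraph V) (ℓ : ℕ) : Prop :=
  ∀ (a b : V) (p r : G.Walk a b), p.IsPath → r.IsPath → p.length + r.length ≤ 2 * ℓ + 1 → p = r

theorem shortPathUnique_of_free {V : Type*} (G : SimpleGraph V) (ℓ : ℕ) (A : Set V)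
    (hbip : ∀ u v, G.Adj u v → (u ∈ A ↔ v ∉ A)) (hfree : EvenCycleFree G ℓ) :
    ShortPathUnique G ℓ := by
  classical
  intro a b p r hp hr hlen
  by_contra hne
  set K : SimpleGraph V := fromEdgeSet {e | e ∈ p.edges ∨ e ∈ r.edges} with hK
  have hKG : K ≤ G := by
    intro x y hxy
    rw [hK, fromEdgeSet_adj] at hxy
    rcases hxy.1 with h | h
    · exact p.adj_of_mem_edges h
    · exact r.adj_of_mem_edges h
  have hpK : ∀ e ∈ p.edges, e ∈ K.edgeSet := by
    intro e he
    rw [hK, edgeSet_fromEdgeSet]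
    exact ⟨Or.inl he, G.not_isDiag_of_mem_edgeSet (p.edges_subset_edgeSet he)⟩
  have hrK : ∀ e ∈ r.edges, e ∈ K.edgeSet := by
    intro e he
    rw [hK, edgeSet_fromEdgeSet]
    exact ⟨Or.inr he, G.not_isDiag_of_mem_edgeSet (r.edges_subset_edgeSet he)⟩
  have hnac : ¬ K.IsAcyclic := by
    intro hac
    have h := (hac.subsingleton_path a b).elim ⟨p.transfer K hpK, hp.transfer hpK⟩
      ⟨r.transfer K hrK, hr.transfer hrK⟩
    have h2 : p.transfer K hpK = r.transfer K hrK := congrArg Subtype.val h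
    have h3 := congrArg Walk.support h2
    rw [Walk.support_transfer, Walk.support_transfer] at h3
    exact hne (Walk.ext_support h3)
  unfold SimpleGraph.IsAcyclic at hnac
  push Not at hnac
  obtain ⟨v, c, hc⟩ := hnac
  have hclen : c.length ≤ p.length + r.length := by
    have h1 : c.edges ⊆ p.edges ++ r.edges := by
      intro e he
      have := c.edges_subset_edgeSet he
      rw [hK, edgeSet_fromEdgeSet] at this
      exact List.mem_append.2 this.1
    have h2 := (hc.edges_nodup.subperm h1).length_le
    simpa using h2
  have hcG : (c.mapLe hKG).IsCycle := hc.mapLe hKG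
  let col : G.Coloring Bool := Coloring.mk (fun v => decide (v ∈ A)) (by
    intro u v huv h
    have := hbip u v huv
    simp only [decide_eq_decide] at h
    tauto)
  have hev : Even (c.mapLe hKG).length := (col.even_length_iff_congr _).2 Iff.rfl
  have h3 := hcG.three_le_length
  have hl : (c.mapLe hKG).length = c.length := by simp [Walk.mapLe]
  obtain ⟨m, hm⟩ := hev
  exact hfree m (by omega) (by omega) ⟨v, c.mapLe hKG, hcG, by omega⟩

theorem shortPathUnique_induce {V : Type*} (G : SimpleGraph V) (ℓ : ℕ) (S : Set V)
    (h : ShortPathUnique G ℓ) : ShortPathUnique (G.induce S) ℓ := by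
  intro a b p r hp hr hlen
  have hinj : Function.Injective (Embedding.induce (G := G) S).toHom := Subtype.val_injective
  apply Walk.map_injective_of_injective hinj
  apply h
  · exact (Walk.isPath_map_iff_of_injective hinj).2 hp
  · exact (Walk.isPath_map_iff_of_injective hinj).2 hr
  · rw [Walk.length_map, Walk.length_map]; exact hlen

open Classical in
/-- Vertices reached by non-backtracking walks of length `i` past the dart `(u, v)`. -/
noncomputable def reach {V : Type*} [Fintype V] (H : SimpleGraph V) : ℕ → V → V → Finset V
  | 0, _, v => {v}
  | i + 1, u, v => ((H.neighborFinset v).erase u).biUnion (fun w => reach H i v w)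

theorem reach_path {V : Type*} [Fintype V] (H : SimpleGraph V) (ℓ : ℕ)
    (hP : ShortPathUnique H ℓ) (i : ℕ) : ∀ (u v x : V), i ≤ ℓ → H.Adj u v → x ∈ reach H i u v →
    ∃ p : H.Walk v x, p.IsPath ∧ p.length = i ∧ u ∉ p.support := by
  classical
  induction i with
  | zero =>
    intro u v x _ huv hx
    simp only [reach, Finset.mem_singleton] at hx
    subst hx
    exact ⟨Walk.nil, Walk.IsPath.nil, rfl, by simpa using huv.ne⟩
  | succ i ih =>
    intro u v x hi huv hx
    simp only [reach, Finset.mem_biUnion, Finset.mem_erase, mem_neighborFinset] at hx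
    obtain ⟨w, ⟨hwu, hvw⟩, hx⟩ := hx
    obtain ⟨p, hp, hpl, hps⟩ := ih v w x (by omega) hvw hx
    refine ⟨Walk.cons hvw p, (Walk.cons_isPath_iff _ _).2 ⟨hp, hps⟩, by simp [hpl], ?_⟩
    rw [Walk.support_cons, List.mem_cons]
    rintro (h | h)
    · exact huv.ne h
    · have hq : (Walk.cons hvw (p.takeUntil u h)).IsPath :=
        (Walk.cons_isPath_iff _ _).2 ⟨hp.takeUntil h,
          fun h' => hps (p.support_takeUntil_subset_support h h')⟩
      have he : (Walk.cons huv.symm Walk.nil : H.Walk v u).IsPath := by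
        simp [huv.ne']
      have hl := p.length_takeUntil_le_length h
      have := hP v u _ _ hq he (by simp; omega)
      simp only [Walk.cons.injEq] at this
      exact hwu this.1

/-- the counting recursion. -/
theorem reach_card_succ {V : Type*} [Fintype V] [DecidableEq V] (H : SimpleGraph V)
    [DecidableRel H.Adj] (ℓ : ℕ)
    (hP : ShortPathUnique H ℓ) (i : ℕ) (hi : i + 1 ≤ ℓ) (u v : V) :
    (reach H (i + 1) u v).card =
      ∑ w ∈ (H.neighborFinset v).erase u, (reach H i v w).card := by
  classical
  have : reach H (i + 1) u v = ((H.neighborFinset v).erase u).biUnion (fun w => reach H i v w) := by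
    ext x
    simp [reach]
  rw [this, Finset.card_biUnion]
  intro w hw w' hw' hne
  simp only [Finset.mem_coe, Finset.mem_erase, mem_neighborFinset] at hw hw'
  change Disjoint (reach H i v w) (reach H i v w')
  rw [Finset.disjoint_left]
  intro x hx hx'
  obtain ⟨p, hp, hpl, hps⟩ := reach_path H ℓ hP i v w x (by omega) hw.2 hx
  obtain ⟨p', hp', hpl', hps'⟩ := reach_path H ℓ hP i v w' x (by omega) hw'.2 hx'
  have := hP v x _ _ ((Walk.cons_isPath_iff hw.2 _).2 ⟨hp, hps⟩)
    ((Walk.cons_isPath_iff hw'.2 _).2 ⟨hp', hps'⟩) (by simp; omega)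
  simp only [Walk.cons.injEq] at this
  exact hne this.1

theorem reach_total {V : Type*} [Fintype V] [DecidableEq V] (H : SimpleGraph V) (ℓ : ℕ)
    (hP : ShortPathUnique H ℓ) (u v : V) (huv : H.Adj u v) :
    ((Finset.range (ℓ + 1)).biUnion (fun i => reach H i u v ∪ reach H i v u)).card =
    ∑ i ∈ Finset.range (ℓ + 1), ((reach H i u v).card + (reach H i v u).card) := by
  have key : ∀ (u v : V) (_ : H.Adj u v) (i j : ℕ), i ≤ ℓ → j ≤ ℓ →
      Disjoint (reach H i u v) (reach H j v u) := by
    intro u v huv i j hi hj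
    rw [Finset.disjoint_left]
    intro x hx hx'
    obtain ⟨p, hp, hpl, hps⟩ := reach_path H ℓ hP i u v x hi huv hx
    obtain ⟨r, hr, hrl, hrs⟩ := reach_path H ℓ hP j v u x hj huv.symm hx'
    have := hP u x _ _ ((Walk.cons_isPath_iff huv _).2 ⟨hp, hps⟩) hr (by simp; omega)
    rw [← this] at hrs
    simp at hrs
  have key2 : ∀ (u v : V) (_ : H.Adj u v) (i j : ℕ), i ≤ ℓ → j ≤ ℓ → i ≠ j →
      Disjoint (reach H i u v) (reach H j u v) := by
    intro u v huv i j hi hj hne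
    rw [Finset.disjoint_left]
    intro x hx hx'
    obtain ⟨p, hp, hpl, hps⟩ := reach_path H ℓ hP i u v x hi huv hx
    obtain ⟨r, hr, hrl, hrs⟩ := reach_path H ℓ hP j u v x hj huv hx'
    have := hP v x p r hp hr (by omega)
    rw [this] at hpl
    omega
  rw [Finset.card_biUnion]
  · apply Finset.sum_congr rfl
    intro i hi
    have : i ≤ ℓ := by simp at hi; omega
    exact Finset.card_union_of_disjoint (key u v huv i i this this)
  · intro i hi j hj hij
    have hi' : i ≤ ℓ := by simp at hi; omega
    have hj' : j ≤ ℓ := by simp at hj; omega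
    simp only [Finset.disjoint_union_left, Finset.disjoint_union_right]
    exact ⟨⟨key2 u v huv i j hi' hj' hij, (key v u huv.symm i j hi' hj')⟩,
      (key u v huv i j hi' hj'), key2 v u huv.symm i j hi' hj' hij⟩

theorem log_tangent_lt {x q : ℝ} (hx : 1 ≤ x) (hq : 1 ≤ q) (hne : x ≠ q) :
    (q + 1) / q * (x - q) < (x + 1) * (Real.log x - Real.log q) := by
  have hx0 : 0 < x := by linarith
  have hq0 : 0 < q := by linarith
  rcases lt_or_gt_of_ne hne with h | h
  · have hy : 0 < Real.log q - Real.log x := by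
      have := Real.log_lt_log hx0 h
      linarith
    have h1 := Real.self_lt_sinh_iff.2 hy
    rw [Real.sinh_eq, neg_sub, Real.exp_sub, Real.exp_sub, Real.exp_log hx0, Real.exp_log hq0] at h1
    have h2 : (x + 1) * ((q / x - x / q) / 2) ≤ (q + 1) / q * (q - x) := by
      have : (q + 1) / q * (q - x) - (x + 1) * ((q / x - x / q) / 2) =
          (q - x) * ((x - 1) * (q - x)) / (2 * q * x) := by
        field_simp
        ring
      have h3 : 0 ≤ (q - x) * ((x - 1) * (q - x)) / (2 * q * x) := by
        apply div_nonneg _ (by positivity)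
        apply mul_nonneg (by linarith)
        apply mul_nonneg (by linarith) (by linarith)
      linarith
    have h4 := mul_lt_mul_of_pos_left h1 (show 0 < x + 1 by linarith)
    linarith
  · have h1 := Real.lt_log_one_add_of_pos (x := x / q - 1) (by
      rw [sub_pos, lt_div_iff₀ hq0]; linarith)
    rw [show 1 + (x / q - 1) = x / q by ring, Real.log_div hx0.ne' hq0.ne'] at h1
    have h4 := mul_lt_mul_of_pos_left h1 (show 0 < x + 1 by linarith)
    refine lt_of_le_of_lt ?_ h4
    have : (x + 1) * (2 * (x / q - 1) / (x / q - 1 + 2)) - (q + 1) / q * (x - q) =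
        (x - q) * ((q - 1) * (x - q)) / (q * (x + q)) := by
      have : x / q - 1 + 2 = (x + q) / q := by field_simp; ring
      rw [this]
      field_simp
      ring
    have h3 : 0 ≤ (x - q) * ((q - 1) * (x - q)) / (q * (x + q)) := by
      apply div_nonneg _ (by positivity)
      apply mul_nonneg (by linarith)
      apply mul_nonneg (by linarith) (by linarith)
    linarith

theorem log_tangent_le {x q : ℝ} (hx : 1 ≤ x) (hq : 1 ≤ q) :
    (q + 1) / q * (x - q) ≤ (x + 1) * (Real.log x - Real.log q) := by
  by_cases h : x = q
  · subst h; simp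
  · exact (log_tangent_lt hx hq h).le

theorem log_sum_ge {ι : Type*} (s : Finset ι) (hs : s.Nonempty) (f : ι → ℝ)
    (hf : ∀ i ∈ s, 0 < f i) :
    Real.log s.card + (1 / (s.card : ℝ)) * ∑ i ∈ s, Real.log (f i) ≤ Real.log (∑ i ∈ s, f i) := by
  have hm : (0 : ℝ) < s.card := by exact_mod_cast hs.card_pos
  have hS : 0 < ∑ i ∈ s, f i := Finset.sum_pos hf hs
  set T := ∑ i ∈ s, f i with hT
  have h : ∀ i ∈ s, Real.log (f i) ≤ (Real.log T - Real.log s.card) + (f i * (s.card / T) - 1) := by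
    intro i hi
    have h1 := Real.log_le_sub_one_of_pos (show 0 < f i * (s.card / T) from
      mul_pos (hf i hi) (div_pos hm hS))
    rw [Real.log_mul (hf i hi).ne' (div_pos hm hS).ne', Real.log_div hm.ne' hS.ne'] at h1
    linarith
  have h2 := Finset.sum_le_sum h
  rw [Finset.sum_add_distrib, Finset.sum_const, Finset.sum_sub_distrib, ← Finset.sum_mul, ← hT,
    Finset.sum_const, nsmul_eq_mul, nsmul_eq_mul, mul_div_cancel₀ _ hS.ne'] at h2
  have h3 : (1 / (s.card : ℝ)) * ∑ i ∈ s, Real.log (f i) ≤ (1 / (s.card : ℝ)) *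
      (s.card * (Real.log T - Real.log s.card)) := by
    apply mul_le_mul_of_nonneg_left _ (by positivity)
    linarith
  rw [← mul_assoc, one_div, inv_mul_cancel₀ hm.ne', one_mul] at h3
  rw [one_div]
  linarith

theorem rat_root (ℓ n : ℕ) (hℓ : 2 ≤ ℓ) (r : ℚ) (h : (n : ℚ) = 2 * ∑ i ∈ Finset.range (ℓ + 1), r ^ i) :
    r.den = 1 := by
  set a : ℤ := r.num with ha
  set b : ℕ := r.den with hb
  have hb0 : (b : ℚ) ≠ 0 := by exact_mod_cast r.den_nz
  have hr : r = a / b := (Rat.num_div_den r).symm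
  have hcop : IsCoprime a (b : ℤ) := by
    rw [Int.isCoprime_iff_nat_coprime]
    simpa using r.reduced
  obtain ⟨k, rfl⟩ : ∃ k, ℓ = k + 2 := ⟨ℓ - 2, by omega⟩
  have hZ : (n : ℤ) * b ^ (k + 2) = 2 * (b * (∑ i ∈ Finset.range (k + 2), a ^ i * b ^ (k + 1 - i)) + a ^ (k + 2)) := by
    have : ((n : ℤ) * b ^ (k + 2) : ℚ) = 2 * (b * (∑ i ∈ Finset.range (k + 2), a ^ i * b ^ (k + 1 - i)) + a ^ (k + 2)) := by
      push_cast
      rw [h, Finset.sum_range_succ, mul_assoc, add_mul, Finset.sum_mul, Finset.mul_sum, hr]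
      congr 2
      · apply Finset.sum_congr rfl
        intro i hi
        have hi : i < k + 2 := by simpa using hi
        obtain ⟨j, hj⟩ : ∃ j, k + 1 = i + j := ⟨k + 1 - i, by omega⟩
        rw [show k + 2 = i + j + 1 by omega, hj, Nat.add_sub_cancel_left, div_pow]
        field_simp
        ring
      · rw [div_pow]; field_simp
    exact_mod_cast this
  have hd : (b : ℤ) ∣ 2 * a ^ (k + 2) := by
    refine ⟨n * b ^ (k + 1) - 2 * (∑ i ∈ Finset.range (k + 2), a ^ i * b ^ (k + 1 - i)), ?_⟩
    linear_combination -hZ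
  have hd2 : (b : ℤ) ∣ 2 := (hcop.symm.pow_right).dvd_of_dvd_mul_right hd
  have hd3 : b ∣ 2 := by exact_mod_cast hd2
  rcases (Nat.dvd_prime Nat.prime_two).1 hd3 with h1 | h1
  · exact h1
  · exfalso
    rw [h1] at hZ hcop
    have h2 : (2 : ℤ) ∣ a ^ (k + 2) := by
      refine ⟨n * 2 ^ k - ∑ i ∈ Finset.range (k + 2), a ^ i * ((2 : ℕ) : ℤ) ^ (k + 1 - i), ?_⟩
      have := hZ
      push_cast at this ⊢
      rw [pow_succ, pow_succ] at this
      linarith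
    have h3 := Int.prime_two.dvd_of_dvd_pow h2
    have := hcop.isUnit_of_dvd' h3 (by norm_num)
    exact absurd this (by decide)

theorem sum_erase_avg {V : Type*} [DecidableEq V] (N : Finset V) (hN : 2 ≤ N.card) (f : V → ℝ) :
    ∑ u ∈ N, 1 / ((N.card : ℝ) - 1) * ∑ w ∈ N.erase u, f w = ∑ w ∈ N, f w := by
  have h2 : (2 : ℝ) ≤ N.card := by exact_mod_cast hN
  have h1 : ∀ u ∈ N, 1 / ((N.card : ℝ) - 1) * ∑ w ∈ N.erase u, f w =
      1 / ((N.card : ℝ) - 1) * (∑ w ∈ N, f w - f u) := by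
    intro u hu
    rw [← Finset.add_sum_erase N f hu]
    ring
  rw [Finset.sum_congr rfl h1, ← Finset.mul_sum, Finset.sum_sub_distrib, Finset.sum_const,
    nsmul_eq_mul]
  have : (N.card : ℝ) - 1 ≠ 0 := by linarith
  field_simp

theorem dart_swap {V : Type*} [Fintype V] [DecidableEq V] (H : SimpleGraph V) [DecidableRel H.Adj]
    (F : V → V → ℝ) :
    ∑ u, ∑ v ∈ H.neighborFinset u, F u v = ∑ v, ∑ u ∈ H.neighborFinset v, F u v := by
  apply Finset.sum_comm'
  intro x y
  simp [H.adj_comm]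

theorem reach_pos {V : Type*} [Fintype V] [DecidableEq V] (H : SimpleGraph V) [DecidableRel H.Adj]
    (hdeg : ∀ v, 2 ≤ H.degree v) (i : ℕ) : ∀ u v, 0 < (reach H i u v).card := by
  induction i with
  | zero => intro u v; simp [reach]
  | succ i ih =>
    intro u v
    have h1 : 0 < ((H.neighborFinset v).erase u).card := by
      have := Finset.pred_card_le_card_erase (s := H.neighborFinset v) (a := u)
      have h2 := hdeg v
      rw [← H.card_neighborFinset_eq_degree] at h2
      omega
    obtain ⟨w, hw⟩ := Finset.card_pos.1 h1
    obtain ⟨x, hx⟩ := Finset.card_pos.1 (ih v w)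
    refine Finset.card_pos.2 ⟨x, ?_⟩
    simp only [Finset.mem_erase, mem_neighborFinset] at hw
    simp only [reach, Finset.mem_biUnion, Finset.mem_erase, mem_neighborFinset]
    exact ⟨w, hw, hx⟩

/-- Sum of `log` of the numbers of non-backtracking walks. -/
theorem log_reach {V : Type*} [Fintype V] [DecidableEq V] (H : SimpleGraph V) [DecidableRel H.Adj]
    (ℓ : ℕ) (hP : ShortPathUnique H ℓ) (hdeg : ∀ v, 2 ≤ H.degree v) (i : ℕ) (hi : i ≤ ℓ) :
    i * (∑ v, (H.degree v : ℝ) * Real.log ((H.degree v : ℝ) - 1)) ≤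
      ∑ u, ∑ v ∈ H.neighborFinset u, Real.log (reach H i u v).card := by
  induction i with
  | zero => simp [reach]
  | succ i ih =>
    have ih := ih (by omega)
    have hstat : ∑ u, ∑ v ∈ H.neighborFinset u, (1 / ((H.degree v : ℝ) - 1) *
        ∑ w ∈ (H.neighborFinset v).erase u, Real.log (reach H i v w).card) =
        ∑ v, ∑ w ∈ H.neighborFinset v, Real.log (reach H i v w).card := by
      rw [dart_swap]
      apply Finset.sum_congr rfl
      intro v _
      have := hdeg v
      rw [← H.card_neighborFinset_eq_degree] at this
      have h := sum_erase_avg (H.neighborFinset v) this (fun w => Real.log (reach H i v w).card)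
      rw [H.card_neighborFinset_eq_degree] at h
      exact h
    have hC : ∑ u, ∑ v ∈ H.neighborFinset u, Real.log ((H.degree v : ℝ) - 1) =
        ∑ v, (H.degree v : ℝ) * Real.log ((H.degree v : ℝ) - 1) := by
      rw [dart_swap]
      apply Finset.sum_congr rfl
      intro v _
      rw [Finset.sum_const, nsmul_eq_mul, H.card_neighborFinset_eq_degree]
    have hstep : ∑ u, ∑ v ∈ H.neighborFinset u, (Real.log ((H.degree v : ℝ) - 1) +
        1 / ((H.degree v : ℝ) - 1) *
        ∑ w ∈ (H.neighborFinset v).erase u, Real.log (reach H i v w).card) ≤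
        ∑ u, ∑ v ∈ H.neighborFinset u, Real.log (reach H (i + 1) u v).card := by
      apply Finset.sum_le_sum
      intro u _
      apply Finset.sum_le_sum
      intro v hv
      rw [mem_neighborFinset] at hv
      rw [reach_card_succ H ℓ hP i hi u v]
      have hcard : ((H.neighborFinset v).erase u).card = H.degree v - 1 := by
        rw [Finset.card_erase_of_mem (by simpa using hv.symm), H.card_neighborFinset_eq_degree]
      have hd := hdeg v
      have hne : ((H.neighborFinset v).erase u).Nonempty := Finset.card_pos.1 (by omega)
      have h := log_sum_ge _ hne (fun w => ((reach H i v w).card : ℝ))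
        (fun w _ => by exact_mod_cast reach_pos H hdeg i v w)
      rw [hcard, Nat.cast_sub (by omega), Nat.cast_one] at h
      push_cast
      exact h
    simp only [Finset.sum_add_distrib] at hstep
    rw [hstat, hC] at hstep
    push_cast
    linarith

theorem moore_bound {V : Type*} [Fintype V] [DecidableEq V] [Nonempty V] (H : SimpleGraph V)
    [DecidableRel H.Adj] (ℓ : ℕ) (hℓ : 1 ≤ ℓ) (hP : ShortPathUnique H ℓ)
    (hdeg : ∀ v, 2 ≤ H.degree v) (q : ℝ) (hq : 1 ≤ q)
    (hsum : (q + 1) * Fintype.card V ≤ ∑ v, (H.degree v : ℝ)) :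
    2 * ∑ i ∈ Finset.range (ℓ + 1), q ^ i ≤ Fintype.card V ∧
    ((Fintype.card V : ℝ) ≤ 2 * ∑ i ∈ Finset.range (ℓ + 1), q ^ i →
      ∀ v, (H.degree v : ℝ) = q + 1) := by
  classical
  have hq0 : 0 < q := by linarith
  set M : ℝ := ∑ v, (H.degree v : ℝ) with hM
  set C : ℝ := ∑ v, (H.degree v : ℝ) * Real.log ((H.degree v : ℝ) - 1) with hC
  have hcV : (0 : ℝ) < Fintype.card V := by exact_mod_cast Fintype.card_pos
  have hM0 : 0 < M := lt_of_lt_of_le (by positivity) hsum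
  have hd2 : ∀ v, (2 : ℝ) ≤ H.degree v := fun v => by exact_mod_cast hdeg v
  -- entropy
  have hdiff : C - M * Real.log q = ∑ v, (((H.degree v : ℝ) - 1) + 1) *
      (Real.log ((H.degree v : ℝ) - 1) - Real.log q) := by
    rw [hC, hM, Finset.sum_mul, ← Finset.sum_sub_distrib]
    apply Finset.sum_congr rfl
    intro v _
    ring
  have hlin : 0 ≤ ∑ v, (q + 1) / q * (((H.degree v : ℝ) - 1) - q) := by
    rw [← Finset.mul_sum]
    apply mul_nonneg (by positivity)
    simp only [Finset.sum_sub_distrib, Finset.sum_const, nsmul_eq_mul, Finset.card_univ]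
    rw [← hM]
    linarith
  have hδ : 0 ≤ C - M * Real.log q := by
    rw [hdiff]
    refine hlin.trans (Finset.sum_le_sum fun v _ => ?_)
    exact log_tangent_le (by linarith [hd2 v]) hq
  have hδ' : (∃ v, (H.degree v : ℝ) ≠ q + 1) → 0 < C - M * Real.log q := by
    rintro ⟨v, hv⟩
    rw [hdiff]
    refine hlin.trans_lt (Finset.sum_lt_sum (fun v _ => ?_) ⟨v, Finset.mem_univ v, ?_⟩)
    · exact log_tangent_le (by linarith [hd2 v]) hq
    · exact log_tangent_lt (by linarith [hd2 v]) hq (fun h => hv (by linarith))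
  -- number of walks
  have hN : ∀ i ≤ ℓ, q ^ i * M + q ^ i * (i * (C - M * Real.log q)) ≤
      ∑ u, ∑ v ∈ H.neighborFinset u, ((reach H i u v).card : ℝ) := by
    intro i hi
    have h1 := log_reach H ℓ hP hdeg i hi
    have hqi : 0 < q ^ i := by positivity
    have h2 : ∑ u, ∑ v ∈ H.neighborFinset u,
        (q ^ i * (1 - i * Real.log q) + q ^ i * Real.log (reach H i u v).card) ≤
        ∑ u, ∑ v ∈ H.neighborFinset u, ((reach H i u v).card : ℝ) := by
      apply Finset.sum_le_sum
      intro u _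
      apply Finset.sum_le_sum
      intro v _
      have hc : (0 : ℝ) < (reach H i u v).card := by exact_mod_cast reach_pos H hdeg i u v
      have := Real.log_le_sub_one_of_pos (div_pos hc hqi)
      rw [Real.log_div hc.ne' hqi.ne', Real.log_pow] at this
      have h3 := mul_le_mul_of_nonneg_left this hqi.le
      rw [mul_sub (q ^ i) (_ / _), mul_div_cancel₀ _ hqi.ne'] at h3
      linarith
    simp only [Finset.sum_add_distrib, Finset.sum_const, nsmul_eq_mul,
      H.card_neighborFinset_eq_degree, ← Finset.mul_sum, ← Finset.sum_mul] at h2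
    rw [← hM] at h2
    have h4 := mul_le_mul_of_nonneg_left h1 hqi.le
    rw [← hC] at h4
    linarith
  -- upper bound
  have hup : ∑ i ∈ Finset.range (ℓ + 1), 2 * (∑ u, ∑ v ∈ H.neighborFinset u,
      ((reach H i u v).card : ℝ)) ≤ M * Fintype.card V := by
    have h1 : ∑ u, ∑ v ∈ H.neighborFinset u, (∑ i ∈ Finset.range (ℓ + 1),
        (((reach H i u v).card : ℝ) + (reach H i v u).card)) ≤
        ∑ u, ∑ v ∈ H.neighborFinset u, (Fintype.card V : ℝ) := by
      apply Finset.sum_le_sum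
      intro u _
      apply Finset.sum_le_sum
      intro v hv
      rw [mem_neighborFinset] at hv
      have := reach_total H ℓ hP u v hv
      have h2 := Finset.card_le_univ
        ((Finset.range (ℓ + 1)).biUnion (fun i => reach H i u v ∪ reach H i v u))
      rw [this] at h2
      exact_mod_cast h2
    simp only [Finset.sum_const, nsmul_eq_mul, H.card_neighborFinset_eq_degree,
      ← Finset.sum_mul] at h1
    rw [← hM] at h1
    refine le_trans (le_of_eq ?_) h1
    have h3 : ∑ u, ∑ v ∈ H.neighborFinset u, (∑ i ∈ Finset.range (ℓ + 1),
        (((reach H i u v).card : ℝ) + (reach H i v u).card)) =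
        ∑ i ∈ Finset.range (ℓ + 1), ∑ u, ∑ v ∈ H.neighborFinset u,
        (((reach H i u v).card : ℝ) + (reach H i v u).card) := by
      rw [Finset.sum_comm]
      apply Finset.sum_congr rfl
      intro u _
      rw [Finset.sum_comm]
    rw [h3]
    apply Finset.sum_congr rfl
    intro i _
    simp only [Finset.sum_add_distrib]
    rw [dart_swap H (fun u v => ((reach H i v u).card : ℝ))]
    ring
  have hall : ∑ i ∈ Finset.range (ℓ + 1), 2 * (q ^ i * M + q ^ i * (i * (C - M * Real.log q))) ≤
      M * Fintype.card V := by
    refine le_trans (Finset.sum_le_sum fun i hi => ?_) hup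
    have := hN i (by simp at hi; omega)
    linarith
  have hsplit : ∑ i ∈ Finset.range (ℓ + 1), 2 * (q ^ i * M + q ^ i * (i * (C - M * Real.log q))) =
      M * (2 * ∑ i ∈ Finset.range (ℓ + 1), q ^ i) +
      (C - M * Real.log q) * (2 * ∑ i ∈ Finset.range (ℓ + 1), q ^ i * i) := by
    simp only [Finset.mul_sum]
    rw [← Finset.sum_add_distrib]
    apply Finset.sum_congr rfl
    intro i _
    ring
  rw [hsplit] at hall
  have hpos : 0 < 2 * ∑ i ∈ Finset.range (ℓ + 1), q ^ i * (i : ℝ) := by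
    apply mul_pos two_pos
    apply Finset.sum_pos' (fun i _ => by positivity)
    exact ⟨1, by simp; omega, by simpa using hq0⟩
  constructor
  · have : 0 ≤ (C - M * Real.log q) * (2 * ∑ i ∈ Finset.range (ℓ + 1), q ^ i * i) :=
      mul_nonneg hδ hpos.le
    exact le_of_mul_le_mul_left (by linarith) hM0
  · intro hle v
    by_contra hv
    have h1 := mul_pos (hδ' ⟨v, hv⟩) hpos
    have h2 := mul_le_mul_of_nonneg_left hle hM0.le
    linarith

theorem reach_walk {V : Type*} [Fintype V] (H : SimpleGraph V) (i : ℕ) :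
    ∀ u v x : V, x ∈ reach H i u v → ∃ p : H.Walk v x, p.length = i := by
  classical
  induction i with
  | zero =>
    intro u v x hx
    simp only [reach, Finset.mem_singleton] at hx
    subst hx
    exact ⟨Walk.nil, rfl⟩
  | succ i ih =>
    intro u v x hx
    simp only [reach, Finset.mem_biUnion, Finset.mem_erase, mem_neighborFinset] at hx
    obtain ⟨w, ⟨_, hvw⟩, hx⟩ := hx
    obtain ⟨p, hp⟩ := ih v w x hx
    exact ⟨Walk.cons hvw p, by simp [hp]⟩

theorem moore_diam {V : Type*} [Fintype V] [DecidableEq V] (H : SimpleGraph V)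
    [DecidableRel H.Adj] (ℓ : ℕ) (hP : ShortPathUnique H ℓ) (q : ℕ)
    (hdeg : ∀ v, H.degree v = q + 1)
    (hcard : Fintype.card V = 2 * ∑ i ∈ Finset.range (ℓ + 1), q ^ i) (u x : V) :
    ∃ w : H.Walk u x, w.length ≤ ℓ + 1 := by
  classical
  have hN : ∀ i ≤ ℓ, ∀ u v, H.Adj u v → (reach H i u v).card = q ^ i := by
    intro i
    induction i with
    | zero => intro _ u v _; simp [reach]
    | succ i ih =>
      intro hi u v huv
      rw [reach_card_succ H ℓ hP i hi u v, Finset.sum_congr rfl (g := fun _ => q ^ i),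
        Finset.sum_const, Finset.card_erase_of_mem (by simpa using huv.symm),
        H.card_neighborFinset_eq_degree, hdeg]
      · simp [pow_succ, mul_comm]
      · intro w hw
        simp only [Finset.mem_erase, mem_neighborFinset] at hw
        exact ih (by omega) v w hw.2
  obtain ⟨v, huv⟩ : ∃ v, H.Adj u v := by
    rw [← H.degree_pos_iff_exists_adj, hdeg]
    omega
  have ht := reach_total H ℓ hP u v huv
  have hs : ∑ i ∈ Finset.range (ℓ + 1), ((reach H i u v).card + (reach H i v u).card) =
      Fintype.card V := by
    rw [hcard, Finset.mul_sum]
    apply Finset.sum_congr rfl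
    intro i hi
    have hi : i ≤ ℓ := by simp at hi; omega
    rw [hN i hi u v huv, hN i hi v u huv.symm]
    ring
  have huniv := (Finset.card_eq_iff_eq_univ _).1 (ht.trans hs)
  have hx : x ∈ (Finset.range (ℓ + 1)).biUnion (fun i => reach H i u v ∪ reach H i v u) := by
    rw [huniv]; exact Finset.mem_univ x
  simp only [Finset.mem_biUnion, Finset.mem_range, Finset.mem_union] at hx
  obtain ⟨i, hi, hx | hx⟩ := hx
  · obtain ⟨p, hp⟩ := reach_walk H i _ _ _ hx
    exact ⟨Walk.cons huv p, by simp; omega⟩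
  · obtain ⟨p, hp⟩ := reach_walk H i _ _ _ hx
    exact ⟨p, by omega⟩

theorem induce_degree_eq {V : Type*} [Fintype V] [DecidableEq V] (G : SimpleGraph V)
    [DecidableRel G.Adj] (S : Finset V) (v : {x // x ∈ S})
    [Fintype ((G.induce {x | x ∈ S}).neighborSet v)] :
    (G.induce {x | x ∈ S}).degree v = ∑ y ∈ S, if G.Adj v y then 1 else 0 := by
  rw [Finset.sum_boole, ← card_neighborFinset_eq_degree]
  rw [← Finset.card_map (Function.Embedding.subtype _)]
  simp only [Nat.cast_id]
  congr 1
  ext x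
  simp only [Finset.mem_map, mem_neighborFinset, Function.Embedding.subtype_apply,
    Finset.mem_filter]
  constructor
  · rintro ⟨y, hy, rfl⟩
    exact ⟨y.2, hy⟩
  · rintro ⟨hx, hy⟩
    exact ⟨⟨x, hx⟩, hy, rfl⟩

theorem dsum_erase {V : Type*} [DecidableEq V] (a : V → V → ℕ) (hs : ∀ x y, a x y = a y x)
    (h0 : ∀ x, a x x = 0) (S : Finset V) (v : V) (hv : v ∈ S) :
    ∑ x ∈ S, ∑ y ∈ S, a x y =
      (∑ x ∈ S.erase v, ∑ y ∈ S.erase v, a x y) + 2 * ∑ y ∈ S, a v y := by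
  rw [← Finset.add_sum_erase S _ hv]
  have h1 : ∀ x ∈ S.erase v, ∑ y ∈ S, a x y = a v x + ∑ y ∈ S.erase v, a x y := by
    intro x _
    rw [← Finset.add_sum_erase S _ hv, hs x v]
  rw [Finset.sum_congr rfl h1, Finset.sum_add_distrib, ← Finset.add_sum_erase S (a v) hv, h0]
  ring

theorem min_degree_core {V : Type*} [Fintype V] [DecidableEq V] [Nonempty V] (G : SimpleGraph V)
    [DecidableRel G.Adj] (ℓ : ℕ) (hℓ : 1 ≤ ℓ) (hP : ShortPathUnique G ℓ) (q : ℕ) (hq : 1 ≤ q)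
    (hsum : (q + 1) * Fintype.card V ≤ ∑ v, G.degree v)
    (hcard : Fintype.card V = 2 * ∑ i ∈ Finset.range (ℓ + 1), q ^ i) :
    ∀ v, 2 ≤ G.degree v := by
  classical
  set a : V → V → ℕ := fun x y => if G.Adj x y then 1 else 0 with ha
  have hsymm : ∀ x y, a x y = a y x := fun x y => by simp [ha, G.adj_comm]
  have hzero : ∀ x, a x x = 0 := fun x => by simp [ha]
  have hdega : ∀ v, G.degree v = ∑ y, a v y := by
    intro v
    simp only [ha, Finset.sum_boole, Nat.cast_id, ← card_neighborFinset_eq_degree]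
    congr 1
    ext x
    simp
  set F : Finset (Finset V) := Finset.univ.filter
    (fun S => S.Nonempty ∧ (q + 1) * S.card ≤ ∑ x ∈ S, ∑ y ∈ S, a x y) with hF
  have hFne : F.Nonempty := by
    refine ⟨Finset.univ, ?_⟩
    simp only [hF, Finset.mem_filter, Finset.mem_univ, true_and]
    refine ⟨Finset.univ_nonempty, ?_⟩
    rw [Finset.card_univ]
    simpa only [hdega] using hsum
  obtain ⟨S, hSF, hmin⟩ := Finset.exists_min_image F Finset.card hFne
  simp only [hF, Finset.mem_filter, Finset.mem_univ, true_and] at hSF hmin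
  obtain ⟨hSne, hSsum⟩ := hSF
  have hdegS : ∀ v ∈ S, 2 ≤ ∑ y ∈ S, a v y := by
    intro v hv
    by_contra hlt
    have he := dsum_erase a hsymm hzero S v hv
    have hc := Finset.card_erase_add_one hv
    by_cases hne : (S.erase v).Nonempty
    · have := hmin (S.erase v) ⟨hne, by rw [← hc] at hSsum; nlinarith⟩
      omega
    · rw [Finset.not_nonempty_iff_eq_empty] at hne
      have hS1 : S = {v} := by
        rw [← Finset.insert_erase hv, hne]; rfl
      rw [hS1] at hSsum
      simp [hzero] at hSsum
  have : Nonempty {x // x ∈ S} := ⟨⟨hSne.choose, hSne.choose_spec⟩⟩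
  have hdI : ∀ v : {x // x ∈ S}, (G.induce {x | x ∈ S}).degree v = ∑ y ∈ S, a v y :=
    fun v => induce_degree_eq G S v
  have hm := (moore_bound (V := {x // x ∈ S}) (G.induce {x | x ∈ S}) ℓ hℓ
    (shortPathUnique_induce G ℓ _ hP)
    (fun v => by rw [hdI]; exact hdegS v.1 v.2) (q : ℝ) (by exact_mod_cast hq) (by
      simp only [hdI]
      rw [Fintype.card_coe]
      have : ∑ v : {x // x ∈ S}, ∑ y ∈ S, a v y = ∑ x ∈ S, ∑ y ∈ S, a x y :=
        Finset.sum_coe_sort S (fun x => ∑ y ∈ S, a x y)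
      have h2 := hSsum
      rw [← this] at h2
      exact_mod_cast h2)).1
  rw [Fintype.card_coe] at hm
  have hm' : 2 * ∑ i ∈ Finset.range (ℓ + 1), q ^ i ≤ S.card := by exact_mod_cast hm
  have hSu : S = Finset.univ := by
    rw [← Finset.card_eq_iff_eq_univ]
    have := Finset.card_le_univ S
    omega
  intro v
  rw [hdega]
  have := hdegS v (by rw [hSu]; exact Finset.mem_univ v)
  rwa [hSu] at this

/-- Characterization of equality in the Zarankiewicz bound for even cycles: an
extremal bipartite `𝓒_{2ℓ}`-free graph (with parts `A` and `Aᶜ`) is the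
incidence graph of a generalized `(ℓ+1)`-gon of order `q`. -/
theorem zarankiewicz_even_cycles_equality (ℓ : ℕ) (hℓ : ℓ = 2 ∨ (2 < ℓ ∧ Odd ℓ))
    (n : ℕ) (hn : 1 ≤ n) (q : ℝ) (hq : 0 < q)
    (hnq : (n : ℝ) = 2 * ∑ i ∈ Finset.range (ℓ + 1), q ^ i)
    (G : SimpleGraph (Fin n)) (A : Set (Fin n))
    (hbip : ∀ u v, G.Adj u v → (u ∈ A ↔ v ∉ A))
    (hfree : EvenCycleFree G ℓ)
    (hext : (G.edgeSet.ncard : ℝ) = (q + 1) * n / 2) :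
    -- q is a positive integer
    (∃ qn : ℕ, 0 < qn ∧ (qn : ℝ) = q) ∧
    -- the two parts each have size n/2
    2 * A.ncard = n ∧ 2 * Aᶜ.ncard = n ∧
    -- every vertex has degree q + 1
    (∀ v, ((G.neighborSet v).ncard : ℝ) = q + 1) ∧
    -- any two vertices are at distance at most ℓ + 1
    (∀ u v : Fin n, ∃ w : G.Walk u v, w.length ≤ ℓ + 1) := by
  classical
  have hℓ2 : 2 ≤ ℓ := by omega
  have hn0 : (n : ℝ) ≠ 0 := by positivity
  have : Nonempty (Fin n) := ⟨⟨0, by omega⟩⟩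
  have hP := shortPathUnique_of_free G ℓ A hbip hfree
  have hE : G.edgeSet.ncard = G.edgeFinset.card := by
    rw [Set.ncard_eq_toFinset_card']
    congr 1
  have hqr : q = (((2 * G.edgeSet.ncard / n - 1 : ℚ)) : ℝ) := by
    push_cast
    rw [hext]
    field_simp
    ring
  set r : ℚ := 2 * G.edgeSet.ncard / n - 1 with hr
  have hden : r.den = 1 := by
    apply rat_root ℓ n hℓ2
    rw [hqr] at hnq
    exact_mod_cast hnq
  obtain ⟨k, hk⟩ : ∃ k : ℕ, (k : ℝ) = q := by
    have h1 : r = (r.num : ℚ) := ((Rat.den_eq_one_iff r).1 hden).symm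
    have h2 : q = ((r.num : ℤ) : ℝ) := by
      rw [hqr]
      exact_mod_cast congrArg (fun t : ℚ => (t : ℝ)) h1
    have h3 : 0 ≤ r.num := by
      rw [h2] at hq
      exact_mod_cast hq.le
    refine ⟨r.num.toNat, ?_⟩
    rw [h2]
    exact_mod_cast Int.toNat_of_nonneg h3
  have hk0 : 0 < k := by
    rw [← hk] at hq
    exact_mod_cast hq
  subst hk
  have hncard : n = 2 * ∑ i ∈ Finset.range (ℓ + 1), k ^ i := by exact_mod_cast hnq
  have hsumN : ∑ v, G.degree v = (k + 1) * n := by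
    rw [G.sum_degrees_eq_twice_card_edges, ← hE]
    have : (2 * (G.edgeSet.ncard : ℝ)) = (k + 1) * n := by rw [hext]; ring
    exact_mod_cast this
  have hmin := min_degree_core G ℓ (by omega) hP k hk0 (by rw [hsumN, Fintype.card_fin])
    (by rw [Fintype.card_fin]; exact hncard)
  have hreg : ∀ v, (G.degree v : ℝ) = k + 1 := by
    apply (moore_bound G ℓ (by omega) hP hmin (k : ℝ) (by exact_mod_cast hk0) _).2
    · rw [Fintype.card_fin]; exact hnq.le
    · rw [Fintype.card_fin]; exact_mod_cast hsumN.ge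
  have hregN : ∀ v, G.degree v = k + 1 := fun v => by exact_mod_cast hreg v
  have hbw : G.IsBipartiteWith (A.toFinset : Set (Fin n)) (Aᶜ.toFinset : Set (Fin n)) := by
    simp only [Set.coe_toFinset]
    refine ⟨disjoint_compl_right, ?_⟩
    intro u v huv
    have := hbip u v huv
    simp only [Set.mem_compl_iff]
    tauto
  have hAB := isBipartiteWith_sum_degrees_eq hbw
  simp only [hregN, Finset.sum_const, smul_eq_mul] at hAB
  have hAB' : A.ncard = Aᶜ.ncard := by
    rw [Set.ncard_eq_toFinset_card', Set.ncard_eq_toFinset_card']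
    exact Nat.eq_of_mul_eq_mul_right (by omega) hAB
  have htot := Set.ncard_add_ncard_compl A
  rw [Nat.card_eq_fintype_card, Fintype.card_fin] at htot
  refine ⟨⟨k, hk0, rfl⟩, by omega, by omega, ?_, ?_⟩
  · intro v
    rw [← hreg v, Set.ncard_eq_toFinset_card', ← card_neighborFinset_eq_degree]
    rfl
  · exact moore_diam G ℓ hP k hregN (by rw [Fintype.card_fin]; exact hncard)
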